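/- Suppose η ≥ η₀ = max(n, (32/γ²)·log(256/γ²)) and an oscillation happens at iteration t, i.e. ŵ_t ≥ λ, F(w_t) > 1/(8η), F(w_{t+1}) > 1/(8η), and w̃_{t+1}·w̃_t < 0. Then ŵ_{t+1} ≥ (1 + γ²)·ŵ_t. -/

import Mathlib

open scoped InnerProductSpace BigOperators
open Finset

/-- Logistic loss `F(w) = (1/n) ∑ᵢ log(1 + exp(−⟨w, xᵢ⟩))`. -/
noncomputable def logisticLoss (n : ℕ) (x : Fin n → EuclideanSpace ℝ (Fin 2))
    (w : EuclideanSpace ℝ (Fin 2)) : ℝ :=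
  (n : ℝ)⁻¹ * ∑ i, Real.log (1 + Real.exp (-⟪w, x i⟫_ℝ))

/-- Gradient potential `G(w) = (1/n) ∑ᵢ 1/(exp(⟨w, xᵢ⟩) + 1)`. -/
noncomputable def gradPotential (n : ℕ) (x : Fin n → EuclideanSpace ℝ (Fin 2))
    (w : EuclideanSpace ℝ (Fin 2)) : ℝ :=
  (n : ℝ)⁻¹ * ∑ i, (Real.exp ⟪w, x i⟫_ℝ + 1)⁻¹

/-- Gradient descent iterates: `w₀ = 0`, `w_{t+1} = w_t − η ∇F(w_t)`
(the gradient of the logistic loss is written in closed form). -/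
noncomputable def gdIter (n : ℕ) (x : Fin n → EuclideanSpace ℝ (Fin 2)) (η : ℝ) :
    ℕ → EuclideanSpace ℝ (Fin 2)
  | 0 => 0
  | t + 1 => gdIter n x η t
      + (η / n) • ∑ i, (Real.exp ⟪gdIter n x η t, x i⟫_ℝ + 1)⁻¹ • x i

/-- `γ` is the maximum margin of the dataset `x`:
it is the greatest `m` such that some unit vector `w` satisfies `⟨w, xᵢ⟩ ≥ m` for all `i`. -/
def isMaxMargin (n : ℕ) (x : Fin n → EuclideanSpace ℝ (Fin 2)) (γ : ℝ) : Prop :=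
  IsGreatest {m : ℝ | ∃ w : EuclideanSpace ℝ (Fin 2), ‖w‖ = 1 ∧ ∀ i, m ≤ ⟪w, x i⟫_ℝ} γ

/-- The threshold `λ = log(1/(exp(1/(8η)) − 1))/γ`. -/
noncomputable def lambdaThresh (γ η : ℝ) : ℝ :=
  Real.log (1 / (Real.exp (1 / (8 * η)) - 1)) / γ

/-- An oscillation occurs at iteration `t` if `ŵ_t ≥ λ`, `F(w_t) > 1/(8η)`,
`F(w_{t+1}) > 1/(8η)`, and `w̃_{t+1}·w̃_t < 0`. -/
def oscillationAt (n : ℕ) (x : Fin n → EuclideanSpace ℝ (Fin 2)) (γ η : ℝ)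
    (wst vst : EuclideanSpace ℝ (Fin 2)) (t : ℕ) : Prop :=
  lambdaThresh γ η ≤ ⟪gdIter n x η t, wst⟫_ℝ ∧
  1 / (8 * η) < logisticLoss n x (gdIter n x η t) ∧
  1 / (8 * η) < logisticLoss n x (gdIter n x η (t + 1)) ∧
  ⟪gdIter n x η (t + 1), vst⟫_ℝ * ⟪gdIter n x η t, vst⟫_ℝ < 0

/-- In the plane, an orthonormal pair computes inner products coordinatewise. -/
theorem inner_eq_of_orthonormal_pair {u v : EuclideanSpace ℝ (Fin 2)} (hu : ‖u‖ = 1)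
    (hv : ‖v‖ = 1) (hvu : ⟪v, u⟫_ℝ = 0) (w y : EuclideanSpace ℝ (Fin 2)) :
    ⟪w, y⟫_ℝ = ⟪w, u⟫_ℝ * ⟪u, y⟫_ℝ + ⟪w, v⟫_ℝ * ⟪v, y⟫_ℝ := by
  have ho : Orthonormal ℝ ![u, v] := by
    refine ⟨fun i => ?_, fun i j hij => ?_⟩
    · fin_cases i <;> simp [hu, hv]
    · have huv : ⟪u, v⟫_ℝ = 0 := by rw [real_inner_comm, hvu]
      fin_cases i <;> fin_cases j <;> simp_all
  have hc : Fintype.card (Fin 2) = Module.finrank ℝ (EuclideanSpace ℝ (Fin 2)) := by simp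
  have hb : Orthonormal ℝ (basisOfOrthonormalOfCardEqFinrank ho hc) := by
    rw [coe_basisOfOrthonormalOfCardEqFinrank]; exact ho
  have h := ((basisOfOrthonormalOfCardEqFinrank ho hc).toOrthonormalBasis hb).sum_inner_mul_inner w y
  simpa [Fin.sum_univ_two] using h.symm

/-- If all margins are at least `L`, the logistic loss is at most `log (1 + exp (-L))`. -/
theorem logisticLoss_le {n : ℕ} (hn : 0 < n) {x : Fin n → EuclideanSpace ℝ (Fin 2)}
    {w : EuclideanSpace ℝ (Fin 2)} {L : ℝ} (h : ∀ i, L ≤ ⟪w, x i⟫_ℝ) :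
    logisticLoss n x w ≤ Real.log (1 + Real.exp (-L)) := by
  have hn' : (0 : ℝ) < n := by exact_mod_cast hn
  have hs : ∑ i, Real.log (1 + Real.exp (-⟪w, x i⟫_ℝ)) ≤ n * Real.log (1 + Real.exp (-L)) := by
    refine (Finset.sum_le_card_nsmul univ _ (Real.log (1 + Real.exp (-L))) fun i _ => ?_).trans
      (by simp)
    have := h i
    gcongr
  unfold logisticLoss
  rw [inv_mul_le_iff₀ hn']
  exact hs

/-- A large loss forces a large component orthogonal to the separating direction. -/
theorem sub_lt_abs_inner_of_lt_logisticLoss {n : ℕ} (hn : 0 < n)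
    {x : Fin n → EuclideanSpace ℝ (Fin 2)} (hx : ∀ i, ‖x i‖ ≤ 1) {γ : ℝ}
    {u v : EuclideanSpace ℝ (Fin 2)} (hu : ‖u‖ = 1) (hsep : ∀ i, γ ≤ ⟪u, x i⟫_ℝ)
    (hv : ‖v‖ = 1) (hvu : ⟪v, u⟫_ℝ = 0) {w : EuclideanSpace ℝ (Fin 2)} (hw : 0 ≤ ⟪w, u⟫_ℝ)
    {L : ℝ} (hF : Real.log (1 + Real.exp (-L)) < logisticLoss n x w) :
    γ * ⟪w, u⟫_ℝ - L < |⟪w, v⟫_ℝ| := by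
  by_contra! hcon
  refine hF.not_ge (logisticLoss_le hn fun i => ?_)
  rw [inner_eq_of_orthonormal_pair hu hv hvu w (x i)]
  have hvx : |⟪v, x i⟫_ℝ| ≤ 1 := by
    have h := abs_real_inner_le_norm v (x i)
    rw [hv, one_mul] at h
    exact h.trans (hx i)
  have h₁ : ⟪w, u⟫_ℝ * γ ≤ ⟪w, u⟫_ℝ * ⟪u, x i⟫_ℝ := mul_le_mul_of_nonneg_left (hsep i) hw
  have h₂ : |⟪w, v⟫_ℝ * ⟪v, x i⟫_ℝ| ≤ |⟪w, v⟫_ℝ| := by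
    rw [abs_mul]
    exact mul_le_of_le_one_right (abs_nonneg _) hvx
  linarith [neg_abs_le (⟪w, v⟫_ℝ * ⟪v, x i⟫_ℝ)]

theorem inner_gdIter_succ (n : ℕ) (x : Fin n → EuclideanSpace ℝ (Fin 2)) (η : ℝ) (t : ℕ)
    (u : EuclideanSpace ℝ (Fin 2)) :
    ⟪gdIter n x η (t + 1), u⟫_ℝ = ⟪gdIter n x η t, u⟫_ℝ
      + η / n * ∑ i, (Real.exp ⟪gdIter n x η t, x i⟫_ℝ + 1)⁻¹ * ⟪u, x i⟫_ℝ := by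
  simp only [gdIter, inner_add_left, real_inner_smul_left, sum_inner]
  simp only [real_inner_comm u]

theorem gradPotential_nonneg (n : ℕ) (x : Fin n → EuclideanSpace ℝ (Fin 2))
    (w : EuclideanSpace ℝ (Fin 2)) : 0 ≤ gradPotential n x w := by
  unfold gradPotential
  positivity

theorem gradPotential_zero {n : ℕ} (hn : 0 < n) (x : Fin n → EuclideanSpace ℝ (Fin 2)) :
    gradPotential n x 0 = 1 / 2 := by
  have hn' : (n : ℝ) ≠ 0 := by exact_mod_cast hn.ne'
  simp only [gradPotential, inner_zero_left, Real.exp_zero, sum_const, card_univ,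
    Fintype.card_fin, nsmul_eq_mul]
  field_simp
  norm_num

/-- A step increases the component along the separating direction by at least `γ η G`. -/
theorem le_inner_gdIter_succ {n : ℕ} {x : Fin n → EuclideanSpace ℝ (Fin 2)} {η γ : ℝ}
    (hη : 0 ≤ η) {u : EuclideanSpace ℝ (Fin 2)} (hsep : ∀ i, γ ≤ ⟪u, x i⟫_ℝ) (t : ℕ) :
    ⟪gdIter n x η t, u⟫_ℝ + γ * (η * gradPotential n x (gdIter n x η t))
      ≤ ⟪gdIter n x η (t + 1), u⟫_ℝ := by
  rw [inner_gdIter_succ]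
  have h : (∑ i, (Real.exp ⟪gdIter n x η t, x i⟫_ℝ + 1)⁻¹) * γ
      ≤ ∑ i, (Real.exp ⟪gdIter n x η t, x i⟫_ℝ + 1)⁻¹ * ⟪u, x i⟫_ℝ := by
    rw [Finset.sum_mul]
    exact Finset.sum_le_sum fun i _ => mul_le_mul_of_nonneg_left (hsep i) (by positivity)
  have h' := mul_le_mul_of_nonneg_left h (show 0 ≤ η / n by positivity)
  have e : γ * (η * gradPotential n x (gdIter n x η t))
      = η / n * ((∑ i, (Real.exp ⟪gdIter n x η t, x i⟫_ℝ + 1)⁻¹) * γ) := by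
    unfold gradPotential
    ring
  linarith

/-- A step moves each unit component by at most `η G`. -/
theorem abs_inner_gdIter_succ_sub_le {n : ℕ} {x : Fin n → EuclideanSpace ℝ (Fin 2)}
    (hx : ∀ i, ‖x i‖ ≤ 1) {η : ℝ} (hη : 0 ≤ η) {v : EuclideanSpace ℝ (Fin 2)} (hv : ‖v‖ = 1)
    (t : ℕ) :
    |⟪gdIter n x η (t + 1), v⟫_ℝ - ⟪gdIter n x η t, v⟫_ℝ|
      ≤ η * gradPotential n x (gdIter n x η t) := by
  rw [inner_gdIter_succ, add_sub_cancel_left, abs_mul, abs_of_nonneg (by positivity : 0 ≤ η / n)]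
  have h : |∑ i, (Real.exp ⟪gdIter n x η t, x i⟫_ℝ + 1)⁻¹ * ⟪v, x i⟫_ℝ|
      ≤ ∑ i, (Real.exp ⟪gdIter n x η t, x i⟫_ℝ + 1)⁻¹ := by
    refine (Finset.abs_sum_le_sum_abs _ _).trans (Finset.sum_le_sum fun i _ => ?_)
    have hp : 0 ≤ (Real.exp ⟪gdIter n x η t, x i⟫_ℝ + 1)⁻¹ := by positivity
    have h := abs_real_inner_le_norm v (x i)
    rw [hv, one_mul] at h
    rw [abs_mul, abs_of_nonneg hp]
    exact mul_le_of_le_one_right hp (h.trans (hx i))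
  calc η / n * |∑ i, (Real.exp ⟪gdIter n x η t, x i⟫_ℝ + 1)⁻¹ * ⟪v, x i⟫_ℝ|
      ≤ η / n * ∑ i, (Real.exp ⟪gdIter n x η t, x i⟫_ℝ + 1)⁻¹ :=
        mul_le_mul_of_nonneg_left h (by positivity)
    _ = η * gradPotential n x (gdIter n x η t) := by
        unfold gradPotential
        ring

/-- After the first step the component along the separating direction is at least `γ η / 2`. -/
theorem half_le_inner_gdIter_succ {n : ℕ} (hn : 0 < n) {x : Fin n → EuclideanSpace ℝ (Fin 2)}
    {η γ : ℝ} (hη : 0 ≤ η) (hγ : 0 ≤ γ) {u : EuclideanSpace ℝ (Fin 2)}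
    (hsep : ∀ i, γ ≤ ⟪u, x i⟫_ℝ) (t : ℕ) :
    γ * η / 2 ≤ ⟪gdIter n x η (t + 1), u⟫_ℝ := by
  induction t with
  | zero =>
    have h := le_inner_gdIter_succ hη hsep 0
    simp only [gdIter, gradPotential_zero hn, inner_zero_left] at h ⊢
    linarith
  | succ t ih =>
    have h := le_inner_gdIter_succ hη hsep (t + 1)
    have := mul_nonneg hγ (mul_nonneg hη (gradPotential_nonneg n x (gdIter n x η (t + 1))))
    linarith

theorem four_mul_log_le_of_le {γ η : ℝ} (hγ0 : 0 < γ) (hγ1 : γ < 1)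
    (hη : 32 / γ ^ 2 * Real.log (256 / γ ^ 2) ≤ η) : 4 * Real.log (8 * η) ≤ γ ^ 2 * η := by
  have hγ2 : 0 < γ ^ 2 := by positivity
  have hlog : 0 < Real.log (256 / γ ^ 2) :=
    Real.log_pos (by rw [lt_div_iff₀ hγ2]; nlinarith)
  have hy : Real.log (256 / γ ^ 2) ≤ γ ^ 2 * η / 32 := by
    rw [div_mul_eq_mul_div, div_le_iff₀ hγ2] at hη
    linarith
  have e : 8 * η = 256 / γ ^ 2 * (γ ^ 2 * η / 32) := by field_simp; ring
  have hy0 : 0 < γ ^ 2 * η / 32 := hlog.trans_le hy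
  rw [e, Real.log_mul (by positivity) hy0.ne']
  linarith [Real.log_le_sub_one_of_pos hy0]

/-- The number `L = log (1 / (exp a - 1))` satisfies `log (1 + exp (-L)) = a`. -/
theorem log_one_add_exp_neg_log_one_div {a : ℝ} (ha : 0 < a) :
    Real.log (1 + Real.exp (-Real.log (1 / (Real.exp a - 1)))) = a := by
  have h : 0 < Real.exp a - 1 := by linarith [Real.add_one_lt_exp ha.ne']
  rw [one_div, Real.log_inv, neg_neg, Real.exp_log h, add_sub_cancel, Real.log_exp]

theorem log_one_div_exp_sub_one_le {η : ℝ} (hη : 0 < η) :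
    Real.log (1 / (Real.exp (1 / (8 * η)) - 1)) ≤ Real.log (8 * η) := by
  have ha : 0 < 1 / (8 * η) := by positivity
  have h : 1 / (8 * η) ≤ Real.exp (1 / (8 * η)) - 1 := by
    linarith [Real.add_one_le_exp (1 / (8 * η))]
  have h0 : 0 < Real.exp (1 / (8 * η)) - 1 := ha.trans_le h
  refine Real.log_le_log (by positivity) ?_
  calc 1 / (Real.exp (1 / (8 * η)) - 1) ≤ 1 / (1 / (8 * η)) := one_div_le_one_div_of_le ha h
    _ = 8 * η := one_div_one_div _

theorem stmt_5 (n : ℕ) (hn : 0 < n) (x : Fin n → EuclideanSpace ℝ (Fin 2))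
    (hx : ∀ i, ‖x i‖ ≤ 1) (γ : ℝ) (hγ0 : 0 < γ) (hγ1 : γ < 1)
    (hmm : isMaxMargin n x γ)
    (wst : EuclideanSpace ℝ (Fin 2)) (hws : ‖wst‖ = 1) (hsep : ∀ i, γ ≤ ⟪wst, x i⟫_ℝ)
    (vst : EuclideanSpace ℝ (Fin 2)) (hvs : ‖vst‖ = 1) (hvw : ⟪vst, wst⟫_ℝ = 0)
    (η : ℝ) (hη : max (n : ℝ) (32 / γ ^ 2 * Real.log (256 / γ ^ 2)) ≤ η)
    (t : ℕ) (hosc : oscillationAt n x γ η wst vst t) :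
    (1 + γ ^ 2) * ⟪gdIter n x η t, wst⟫_ℝ ≤ ⟪gdIter n x η (t + 1), wst⟫_ℝ := by
  obtain ⟨-, hF, hF', hneg⟩ := hosc
  have hη0 : 0 < η := lt_of_lt_of_le (by exact_mod_cast hn) ((le_max_left _ _).trans hη)
  rcases t with _ | t
  · simp [gdIter] at hneg
  have hlog := four_mul_log_le_of_le hγ0 hγ1 ((le_max_right _ _).trans hη)
  have hL := log_one_div_exp_sub_one_le hη0
  have hLa := log_one_add_exp_neg_log_one_div (a := 1 / (8 * η)) (by positivity)
  set L := Real.log (1 / (Real.exp (1 / (8 * η)) - 1))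
  rw [← hLa] at hF hF'
  have hm := half_le_inner_gdIter_succ hn hη0.le hγ0.le hsep t
  have hm' := half_le_inner_gdIter_succ hn hη0.le hγ0.le hsep (t + 1)
  have hpos : 0 ≤ γ * η / 2 := by positivity
  have h₁ := sub_lt_abs_inner_of_lt_logisticLoss hn hx hws hsep hvs hvw (hpos.trans hm) hF
  have h₂ := sub_lt_abs_inner_of_lt_logisticLoss hn hx hws hsep hvs hvw (hpos.trans hm') hF'
  have hstep := le_inner_gdIter_succ (n := n) hη0.le hsep (t + 1)
  have hmove := abs_inner_gdIter_succ_sub_le hx hη0.le hvs (t + 1)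
  have hG := mul_nonneg hη0.le (gradPotential_nonneg n x (gdIter n x η (t + 1)))
  set G := η * gradPotential n x (gdIter n x η (t + 1))
  have habs : |⟪gdIter n x η (t + 1), vst⟫_ℝ| + |⟪gdIter n x η (t + 1 + 1), vst⟫_ℝ|
      = |⟪gdIter n x η (t + 1 + 1), vst⟫_ℝ - ⟪gdIter n x η (t + 1), vst⟫_ℝ| := by
    rcases mul_neg_iff.mp hneg with ⟨ha, hb⟩ | ⟨ha, hb⟩
    · rw [abs_of_neg hb, abs_of_pos ha, abs_of_pos (by linarith)]; ring
    · rw [abs_of_pos hb, abs_of_neg ha, abs_of_neg (by linarith)]; ring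
  have hmono : γ * ⟪gdIter n x η (t + 1), wst⟫_ℝ ≤ γ * ⟪gdIter n x η (t + 1 + 1), wst⟫_ℝ :=
    mul_le_mul_of_nonneg_left (by linarith [mul_nonneg hγ0.le hG]) hγ0.le
  have hγm := mul_le_mul_of_nonneg_left hm hγ0.le
  have key : γ * ⟪gdIter n x η (t + 1), wst⟫_ℝ ≤ G := by linarith
  have := mul_le_mul_of_nonneg_left key hγ0.le
  linarith
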